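/- Let X be a GC_5 set of 21 nodes with no maximal line, and suppose a line ℓ̃ is used by four distinct nodes of X. Then ℓ̃ is a 5-node line. -/

import Mathlib

open MvPolynomial

/-- Evaluation of a bivariate polynomial at a point of the real plane. -/
noncomputable def ev (p : MvPolynomial (Fin 2) ℝ) (A : ℝ × ℝ) : ℝ :=
  MvPolynomial.eval ![A.1, A.2] p

/-- A polynomial of total degree exactly 1, defining a line. -/
def IsLinePoly (l : MvPolynomial (Fin 2) ℝ) : Prop := l.totalDegree = 1

/-- The line (zero set) defined by a polynomial. -/
def lineSet (l : MvPolynomial (Fin 2) ℝ) : Set (ℝ × ℝ) := {A | ev l A = 0}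

/-- The number of nodes of `X` lying on the line defined by `l`. -/
noncomputable def nodesOn (X : Set (ℝ × ℝ)) (l : MvPolynomial (Fin 2) ℝ) : ℕ :=
  (X ∩ lineSet l).ncard

/-- `X` is an `n`-poised set: it has `N = (n+2)(n+1)/2` nodes and the only polynomial of
degree ≤ n vanishing on all of `X` is the zero polynomial. -/
def Poised (n : ℕ) (X : Set (ℝ × ℝ)) : Prop :=
  X.Finite ∧ X.ncard = (n + 2) * (n + 1) / 2 ∧
    ∀ p : MvPolynomial (Fin 2) ℝ, p.totalDegree ≤ n → (∀ A ∈ X, ev p A = 0) → p = 0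

/-- `p` is an `n`-fundamental polynomial of the node `A` with respect to `X`. -/
def IsFund (n : ℕ) (X : Set (ℝ × ℝ)) (A : ℝ × ℝ) (p : MvPolynomial (Fin 2) ℝ) : Prop :=
  p.totalDegree ≤ n ∧ ev p A = 1 ∧ ∀ B ∈ X, B ≠ A → ev p B = 0

/-- `X` is a `GC_n` set: it is `n`-poised and each fundamental polynomial is a product of
`n` linear (degree-1) polynomials. -/
def GCSet (n : ℕ) (X : Set (ℝ × ℝ)) : Prop :=
  Poised n X ∧ ∀ A ∈ X, ∃ p : MvPolynomial (Fin 2) ℝ, IsFund n X A p ∧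
    ∃ f : Fin n → MvPolynomial (Fin 2) ℝ, (∀ i, IsLinePoly (f i)) ∧ p = ∏ i, f i

/-- The node `A` uses the line `l`: the linear polynomial `l` divides a fundamental
polynomial of `A`. -/
def Uses (n : ℕ) (X : Set (ℝ × ℝ)) (A : ℝ × ℝ) (l : MvPolynomial (Fin 2) ℝ) : Prop :=
  ∃ p, IsFund n X A p ∧ l ∣ p

/-- `X` has no maximal line, i.e. no line passes through `n+1` nodes of `X`. -/
def NoMaximalLine (n : ℕ) (X : Set (ℝ × ℝ)) : Prop :=
  ∀ l : MvPolynomial (Fin 2) ℝ, IsLinePoly l → nodesOn X l ≠ n + 1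

lemma ev_mul (p q : MvPolynomial (Fin 2) ℝ) (A : ℝ × ℝ) : ev (p * q) A = ev p A * ev q A := by
  simp [ev]

lemma ev_sub (p q : MvPolynomial (Fin 2) ℝ) (A : ℝ × ℝ) : ev (p - q) A = ev p A - ev q A := by
  simp [ev]

lemma ev_C (r : ℝ) (A : ℝ × ℝ) : ev (C r) A = r := by
  simp [ev]

lemma eq_affine_of_totalDegree_le_one {p : MvPolynomial (Fin 2) ℝ} (hp : p.totalDegree ≤ 1) :
    ∃ a b c : ℝ, p = C a * X 0 + C b * X 1 + C c := by
  refine ⟨p.coeff (Finsupp.single 0 1), p.coeff (Finsupp.single 1 1), p.coeff 0, ?_⟩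
  ext d
  have hd : d.degree = d 0 + d 1 := by
    rw [Finsupp.degree_eq_sum, Fin.sum_univ_two]
  have key (e : Fin 2 →₀ ℕ) : e = d ↔ e 0 = d 0 ∧ e 1 = d 1 := by
    rw [Finsupp.ext_iff, Fin.forall_fin_two]
  by_cases h : 1 < d.degree
  · rw [coeff_eq_zero_of_totalDegree_lt (lt_of_le_of_lt hp h)]
    simp only [coeff_add, coeff_C_mul, coeff_X, coeff_C, key]
    rw [hd] at h
    simp
    grind
  · rw [hd] at h
    have : (d 0 = 0 ∧ d 1 = 0) ∨ (d 0 = 1 ∧ d 1 = 0) ∨ (d 0 = 0 ∧ d 1 = 1) := by omega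
    simp only [coeff_add, coeff_C_mul, coeff_X, coeff_C, key]
    rcases this with h | h | h
    · obtain rfl : 0 = d := (key 0).2 (by simp [h])
      simp
    · obtain rfl : Finsupp.single 0 1 = d := (key _).2 (by simp [h])
      simp
    · obtain rfl : Finsupp.single 1 1 = d := (key _).2 (by simp [h])
      simp

lemma IsLinePoly.exists_affine {m : MvPolynomial (Fin 2) ℝ} (hm : IsLinePoly m) :
    ∃ a b c : ℝ, (a ≠ 0 ∨ b ≠ 0) ∧ m = C a * X 0 + C b * X 1 + C c := by
  obtain ⟨a, b, c, h⟩ := eq_affine_of_totalDegree_le_one (le_of_eq hm)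
  refine ⟨a, b, c, ?_, h⟩
  by_contra! hab
  rw [IsLinePoly, h, hab.1, hab.2] at hm
  simp at hm

lemma IsLinePoly.ne_zero {m : MvPolynomial (Fin 2) ℝ} (hm : IsLinePoly m) : m ≠ 0 := by
  rintro rfl
  simp [IsLinePoly] at hm

lemma IsLinePoly.exists_param {m : MvPolynomial (Fin 2) ℝ} (hm : IsLinePoly m) :
    ∃ P v : ℝ × ℝ, v ≠ 0 ∧ ∀ Q, Q ∈ lineSet m ↔ ∃ t : ℝ, P + t • v = Q := by
  obtain ⟨a, b, c, hab, rfl⟩ := hm.exists_affine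
  have hne : a ^ 2 + b ^ 2 ≠ 0 := by
    rcases hab with h | h <;> positivity
  refine ⟨(-c * a / (a ^ 2 + b ^ 2), -c * b / (a ^ 2 + b ^ 2)), (-b, a), ?_, fun Q => ?_⟩
  · intro h
    simp only [Prod.mk_eq_zero, neg_eq_zero] at h
    tauto
  · simp only [lineSet, ev, Set.mem_ofPred_eq, map_add, map_mul, eval_C, eval_X,
      Matrix.cons_val_zero, Matrix.cons_val_one, Prod.ext_iff, Prod.fst_add, Prod.snd_add,
      Prod.smul_fst, Prod.smul_snd, smul_eq_mul]
    constructor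
    · intro h
      obtain rfl : c = -(a * Q.1 + b * Q.2) := by linarith
      refine ⟨(a * Q.2 - b * Q.1) / (a ^ 2 + b ^ 2), ?_, ?_⟩ <;> field_simp <;> ring
    · rintro ⟨t, h1, h2⟩
      rw [← h1, ← h2]
      field_simp
      ring

lemma IsLinePoly.infinite {m : MvPolynomial (Fin 2) ℝ} (hm : IsLinePoly m) :
    (lineSet m).Infinite := by
  obtain ⟨P, v, hv, h⟩ := hm.exists_param
  refine Set.infinite_of_injective_forall_mem (f := fun t : ℝ => P + t • v) ?_
    fun t => (h _).2 ⟨t, rfl⟩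
  intro s t hst
  exact smul_left_injective ℝ hv (add_left_cancel hst)

lemma eval_aeval_line (p : MvPolynomial (Fin 2) ℝ) (P v : ℝ × ℝ) (t : ℝ) :
    (aeval ![Polynomial.C P.1 + Polynomial.C v.1 * Polynomial.X,
      Polynomial.C P.2 + Polynomial.C v.2 * Polynomial.X] p).eval t = ev p (P + t • v) := by
  unfold ev
  induction p using MvPolynomial.induction_on with
  | C r => simp
  | add p q hp hq => rw [map_add, Polynomial.eval_add, hp, hq, map_add]
  | mul_X p i hp =>
    rw [map_mul, Polynomial.eval_mul, hp, map_mul, aeval_X, eval_X]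
    congr 1
    fin_cases i <;> simp <;> ring

lemma ev_eq_zero_of_card_lt {m p : MvPolynomial (Fin 2) ℝ} (hm : IsLinePoly m)
    {T : Finset (ℝ × ℝ)} (hT : ∀ Q ∈ T, Q ∈ lineSet m) (hp : p.totalDegree < T.card)
    (h0 : ∀ Q ∈ T, ev p Q = 0) {Q : ℝ × ℝ} (hQ : Q ∈ lineSet m) : ev p Q = 0 := by
  obtain ⟨P, v, hv, h⟩ := hm.exists_param
  have hpar : ∀ Q : T, ∃ t : ℝ, P + t • v = Q := fun Q => (h _).1 (hT _ Q.2)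
  choose τ hτ using hpar
  have hinj : Function.Injective τ := fun Q R hQR => Subtype.ext <| by rw [← hτ, ← hτ, hQR]
  have hg := Polynomial.eq_zero_of_natDegree_lt_card_of_eval_eq_zero
    (aeval ![Polynomial.C P.1 + Polynomial.C v.1 * Polynomial.X,
      Polynomial.C P.2 + Polynomial.C v.2 * Polynomial.X] p) hinj
    (fun Q => by rw [eval_aeval_line, hτ, h0 _ Q.2]) (by
      refine lt_of_le_of_lt (aeval_natDegree_le (n := 1) p le_rfl _ fun i => ?_)
        (by simpa using hp)
      fin_cases i <;> simp <;> compute_degree)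
  obtain ⟨t, rfl⟩ := (h Q).1 hQ
  rw [← eval_aeval_line, hg, Polynomial.eval_zero]

lemma X_sub_dvd_sub_aeval (i : Fin 2) (g p : MvPolynomial (Fin 2) ℝ) :
    X i - g ∣ p - aeval (Function.update X i g) p := by
  induction p using MvPolynomial.induction_on with
  | C r => simp
  | add p q hp hq =>
    rw [map_add, add_sub_add_comm]
    exact dvd_add hp hq
  | mul_X p j hp =>
    have hX : X i - g ∣ X j - Function.update (X : Fin 2 → MvPolynomial (Fin 2) ℝ) i g j := by
      by_cases hj : j = i
      · subst hj
        simp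
      · simp [hj]
    rw [map_mul, aeval_X, show ∀ a b c d : MvPolynomial (Fin 2) ℝ,
      a * b - c * d = (a - c) * b + c * (b - d) by intros; ring]
    exact dvd_add (hp.mul_right _) (hX.mul_left _)

lemma IsLinePoly.dvd {m p : MvPolynomial (Fin 2) ℝ} (hm : IsLinePoly m)
    (h : ∀ Q ∈ lineSet m, ev p Q = 0) : m ∣ p := by
  have key (i : Fin 2) (g : MvPolynomial (Fin 2) ℝ) (r : ℝ) (hr : r ≠ 0)
      (hmg : m = C r * (X i - g)) (hg : ∀ x, eval (Function.update x i (eval x g)) g = eval x g) :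
      m ∣ p := by
    have h0 : aeval (Function.update X i g) p = 0 := by
      refine MvPolynomial.funext fun x => ?_
      have hx : eval x (aeval (Function.update X i g) p)
          = eval (Function.update x i (eval x g)) p := by
        rw [aeval_def, algebraMap_eq, ← coe_eval₂Hom, ← RingHom.comp_apply]
        congr 1
        ext j
        · simp
        · by_cases hj : j = i
          · subst hj
            simp
          · simp [hj]
      have hvec (y : Fin 2 → ℝ) : ![y 0, y 1] = y := by
        ext j
        fin_cases j <;> rfl
      have := h (Function.update x i (eval x g) 0, Function.update x i (eval x g) 1) (by
        simp only [lineSet, ev, Set.mem_ofPred_eq, hvec, hmg]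
        simp [hg])
      rw [hx, map_zero]
      simpa only [ev, hvec] using this
    have := X_sub_dvd_sub_aeval i g p
    rw [h0, sub_zero] at this
    rw [hmg]
    exact ((isUnit_iff_ne_zero.2 hr).map C).mul_left_dvd.2 this
  obtain ⟨a, b, c, hab, hform⟩ := hm.exists_affine
  rcases hab with ha | hb
  · refine key 0 (C (-b / a) * X 1 + C (-c / a)) a ha ?_ (by simp)
    rw [hform, mul_sub, mul_add, ← mul_assoc, ← C_mul, ← C_mul, mul_div_cancel₀ _ ha,
      mul_div_cancel₀ _ ha, C_neg, C_neg]
    ring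
  · refine key 1 (C (-a / b) * X 0 + C (-c / b)) b hb ?_ (by simp)
    rw [hform, mul_sub, mul_add, ← mul_assoc, ← C_mul, ← C_mul, mul_div_cancel₀ _ hb,
      mul_div_cancel₀ _ hb, C_neg, C_neg]
    ring

/-- A polynomial of degree at most `d + 1` with `d + 2` zeros on a line is divisible by it. -/
lemma exists_eq_mul_of_card_lt {m p : MvPolynomial (Fin 2) ℝ} (hm : IsLinePoly m) {d : ℕ}
    (hp : p.totalDegree ≤ d + 1) {T : Finset (ℝ × ℝ)} (hT : ∀ Q ∈ T, Q ∈ lineSet m)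
    (hcard : d + 2 ≤ T.card) (h0 : ∀ Q ∈ T, ev p Q = 0) :
    ∃ u : MvPolynomial (Fin 2) ℝ, u.totalDegree ≤ d ∧ p = m * u := by
  obtain ⟨u, rfl⟩ := hm.dvd fun Q hQ => ev_eq_zero_of_card_lt hm hT (by omega) h0 hQ
  refine ⟨u, ?_, rfl⟩
  by_cases hu : u = 0
  · simp [hu]
  · rw [totalDegree_mul_of_isDomain hm.ne_zero hu, hm] at hp
    omega

/-- A set of points is a line. -/
def IsLine (s : Set (ℝ × ℝ)) : Prop := ∃ m, IsLinePoly m ∧ lineSet m = s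

lemma IsLine.subset {s t : Set (ℝ × ℝ)} (hs : IsLine s) (ht : IsLine t) {P Q : ℝ × ℝ}
    (hPQ : P ≠ Q) (hPs : P ∈ s) (hQs : Q ∈ s) (hPt : P ∈ t) (hQt : Q ∈ t) : s ⊆ t := by
  classical
  obtain ⟨m, hm, rfl⟩ := hs
  obtain ⟨m', hm', rfl⟩ := ht
  refine fun R hR => ev_eq_zero_of_card_lt hm (T := {P, Q}) ?_ ?_ ?_ hR
  · simp [hPs, hQs]
  · rw [hm', Finset.card_pair hPQ]
    norm_num
  · simpa using ⟨hPt, hQt⟩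

lemma IsLine.eq {s t : Set (ℝ × ℝ)} (hs : IsLine s) (ht : IsLine t) {P Q : ℝ × ℝ}
    (hPQ : P ≠ Q) (hPs : P ∈ s) (hQs : Q ∈ s) (hPt : P ∈ t) (hQt : Q ∈ t) : s = t :=
  (hs.subset ht hPQ hPs hQs hPt hQt).antisymm (ht.subset hs hPQ hPt hQt hPs hQs)

section Counting

open scoped Classical

/-- The points of a finite set lying on `s`. -/
noncomputable def pointsOn (T : Finset (ℝ × ℝ)) (s : Set (ℝ × ℝ)) : Finset (ℝ × ℝ) :=
  {P ∈ T | P ∈ s}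

lemma mem_pointsOn {T : Finset (ℝ × ℝ)} {s : Set (ℝ × ℝ)} {P : ℝ × ℝ} :
    P ∈ pointsOn T s ↔ P ∈ T ∧ P ∈ s := by
  simp [pointsOn]

lemma card_le_of_cover {T : Finset (ℝ × ℝ)} {K : Finset (Set (ℝ × ℝ))} {j : ℕ}
    (hc : ∀ P ∈ T, ∃ s ∈ K, P ∈ s) (hj : ∀ s ∈ K, (pointsOn T s).card ≤ j) :
    T.card ≤ K.card * j := by
  refine le_trans (Finset.card_le_card (t := K.biUnion (pointsOn T)) ?_)
    (Finset.card_biUnion_le_card_mul _ _ _ hj)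
  intro P hP
  obtain ⟨s, hs, hPs⟩ := hc P hP
  exact Finset.mem_biUnion.2 ⟨s, hs, mem_pointsOn.2 ⟨hP, hPs⟩⟩

lemma card_pointsOn_inter_le_one {s t : Set (ℝ × ℝ)} (hs : IsLine s) (ht : IsLine t) (hst : s ≠ t)
    (T : Finset (ℝ × ℝ)) : (pointsOn T (s ∩ t)).card ≤ 1 := by
  rw [Finset.card_le_one]
  intro P hP Q hQ
  by_contra hPQ
  rw [mem_pointsOn] at hP hQ
  exact hst (hs.eq ht hPQ hP.2.1 hQ.2.1 hP.2.2 hQ.2.2)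

lemma sdiff_pointsOn (T : Finset (ℝ × ℝ)) (s : Set (ℝ × ℝ)) :
    T \ pointsOn T s = {P ∈ T | P ∉ s} := by
  ext P
  simp only [Finset.mem_sdiff, mem_pointsOn, Finset.mem_filter]
  tauto

/-- Removing from a zero set of `w` a line containing sufficiently many points. -/
lemma exists_reduced {w : MvPolynomial (Fin 2) ℝ} {d : ℕ} (hw : w.totalDegree ≤ d + 1)
    {L : Finset (Set (ℝ × ℝ))} (hL : ∀ s ∈ L, IsLine s) {T : Finset (ℝ × ℝ)}
    (hT : ∀ P ∈ T, ∃ s ∈ L, P ∈ s) (h0 : ∀ P ∈ T, ev w P = 0) {s : Set (ℝ × ℝ)} (hs : s ∈ L)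
    (hcard : d + 2 ≤ (pointsOn T s).card) :
    ∃ u : MvPolynomial (Fin 2) ℝ, u.totalDegree ≤ d ∧ (∀ P ∈ T \ pointsOn T s, ev u P = 0) ∧
      (∀ P ∈ T \ pointsOn T s, ∃ t ∈ L.erase s, P ∈ t) ∧
      ∀ Q, (Q ∈ s ∨ ev u Q = 0) → ev w Q = 0 := by
  obtain ⟨m, hm, rfl⟩ := hL s hs
  obtain ⟨u, hu, rfl⟩ := exists_eq_mul_of_card_lt hm hw (T := pointsOn T (lineSet m))
    (fun Q hQ => (mem_pointsOn.1 hQ).2) hcard fun Q hQ => h0 Q (mem_pointsOn.1 hQ).1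
  refine ⟨u, hu, fun P hP => ?_, fun P hP => ?_, fun Q hQ => ?_⟩
  · rw [sdiff_pointsOn, Finset.mem_filter] at hP
    have := h0 P hP.1
    rw [ev_mul] at this
    exact (mul_eq_zero.1 this).resolve_left hP.2
  · rw [sdiff_pointsOn, Finset.mem_filter] at hP
    obtain ⟨t, ht, hPt⟩ := hT P hP.1
    exact ⟨t, Finset.mem_erase.2 ⟨fun h => hP.2 (h ▸ hPt), ht⟩, hPt⟩
  · rw [ev_mul]
    rcases hQ with hQ | hQ
    · rw [show ev m Q = 0 from hQ, zero_mul]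
    · rw [hQ, mul_zero]

lemma exists_lt_card_pointsOn {T : Finset (ℝ × ℝ)} {K : Finset (Set (ℝ × ℝ))} {j : ℕ}
    (hc : ∀ P ∈ T, ∃ s ∈ K, P ∈ s) (hj : K.card * j < T.card) :
    ∃ s ∈ K, j + 1 ≤ (pointsOn T s).card := by
  by_contra! h
  exact absurd (card_le_of_cover hc fun s hs => Nat.lt_succ_iff.1 (h s hs)) (not_le.2 hj)

lemma card_sdiff_pointsOn (T : Finset (ℝ × ℝ)) (s : Set (ℝ × ℝ)) :
    (T \ pointsOn T s).card + (pointsOn T s).card = T.card :=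
  Finset.card_sdiff_add_card_eq_card (Finset.filter_subset _ _)

lemma card_pointsOn_mono {T T' : Finset (ℝ × ℝ)} (h : T ⊆ T') (s : Set (ℝ × ℝ)) :
    (pointsOn T s).card ≤ (pointsOn T' s).card :=
  Finset.card_le_card (Finset.filter_subset_filter _ h)

/-- A cubic with ten zeros on three lines, at most four on each, vanishes on these lines. -/
lemma cubic_eq_zero_of_three_lines {w : MvPolynomial (Fin 2) ℝ} (hw : w.totalDegree ≤ 3)
    {L : Finset (Set (ℝ × ℝ))} (hL : ∀ s ∈ L, IsLine s) (hLc : L.card = 3)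
    {T : Finset (ℝ × ℝ)} (hT : ∀ P ∈ T, ∃ s ∈ L, P ∈ s) (h0 : ∀ P ∈ T, ev w P = 0)
    (h4 : ∀ s ∈ L, (pointsOn T s).card ≤ 4) (hTc : 10 ≤ T.card) {Q : ℝ × ℝ} {s : Set (ℝ × ℝ)}
    (hs : s ∈ L) (hQ : Q ∈ s) : ev w Q = 0 := by
  obtain ⟨s₁, hs₁, hc₁⟩ := exists_lt_card_pointsOn (j := 3) hT (by omega)
  obtain ⟨u, hu, hu0, huL, hwu⟩ := exists_reduced hw hL hT h0 hs₁ hc₁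
  have hd₁ := card_sdiff_pointsOn T s₁
  have hb₁ := h4 s₁ hs₁
  have hL₁ : (L.erase s₁).card = 2 := by rw [Finset.card_erase_of_mem hs₁, hLc]
  obtain ⟨s₂, hs₂, hc₂⟩ := exists_lt_card_pointsOn (j := 2) huL (by omega)
  obtain ⟨v, hv, hv0, hvL, huv⟩ := exists_reduced hu
    (fun s hs => hL s (Finset.mem_of_mem_erase hs)) huL hu0 hs₂ hc₂
  have hd₂ := card_sdiff_pointsOn (T \ pointsOn T s₁) s₂
  have hb₂ := (card_pointsOn_mono (Finset.sdiff_subset (s := T) (t := pointsOn T s₁)) s₂).trans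
    (h4 s₂ (Finset.mem_of_mem_erase hs₂))
  have hL₂ : ((L.erase s₁).erase s₂).card = 1 := by rw [Finset.card_erase_of_mem hs₂, hL₁]
  obtain ⟨s₃, hs₃, hc₃⟩ := exists_lt_card_pointsOn (j := 1) hvL (by omega)
  obtain ⟨x, -, -, -, hvx⟩ := exists_reduced hv
    (fun s hs => hL s (Finset.mem_of_mem_erase (Finset.mem_of_mem_erase hs))) hvL hv0 hs₃ hc₃
  by_cases h₁ : s = s₁
  · exact hwu Q (Or.inl (h₁ ▸ hQ))
  refine hwu Q (Or.inr ?_)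
  by_cases h₂ : s = s₂
  · exact huv Q (Or.inl (h₂ ▸ hQ))
  refine huv Q (Or.inr (hvx Q (Or.inl ?_)))
  have h₃ : s = s₃ := Finset.card_le_one.1 hL₂.le s
    (Finset.mem_erase.2 ⟨h₂, Finset.mem_erase.2 ⟨h₁, hs⟩⟩) s₃ hs₃
  exact h₃ ▸ hQ

/-- `L` is the set of the (at most four) lines whose union is the zero set of the quartic `q`. -/
structure IsSplitQuartic (q : MvPolynomial (Fin 2) ℝ) (L : Finset (Set (ℝ × ℝ))) : Prop where
  card_le : L.card ≤ 4
  totalDegree_le : q.totalDegree ≤ 4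
  isLine : ∀ s ∈ L, IsLine s
  ev_eq_zero_iff : ∀ P, ev q P = 0 ↔ ∃ s ∈ L, P ∈ s

lemma exists_mem_line_ev_ne_zero {q : MvPolynomial (Fin 2) ℝ} {L : Finset (Set (ℝ × ℝ))}
    (hq : IsSplitQuartic q L) {s : Set (ℝ × ℝ)} (hs : IsLine s) (hsL : s ∉ L) :
    ∃ R ∈ s, ev q R ≠ 0 := by
  by_contra! h
  have hinf : s.Infinite := by
    obtain ⟨m, hm, rfl⟩ := hs
    exact hm.infinite
  refine hinf (Set.Finite.subset (L.finite_toSet.biUnion (t := fun t => s ∩ t) ?_) ?_)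
  · intro t ht
    refine Set.Subsingleton.finite fun P hP Q hQ => ?_
    by_contra hPQ
    exact hsL (hs.eq (hq.isLine t ht) hPQ hP.1 hQ.1 hP.2 hQ.2 ▸ ht)
  · intro P hP
    obtain ⟨t, ht, hPt⟩ := (hq.ev_eq_zero_iff P).1 (h P hP)
    exact Set.mem_biUnion ht ⟨hP, hPt⟩

/-- Two split quartics without common line, having fifteen common zeros: every quartic through
fourteen of these passes through the last one. -/
lemma ev_eq_zero_of_disjoint {q₁ q₂ q : MvPolynomial (Fin 2) ℝ} {L₁ L₂ : Finset (Set (ℝ × ℝ))}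
    (h₁ : IsSplitQuartic q₁ L₁) (h₂ : IsSplitQuartic q₂ L₂) (hL₁ : L₁.card = 4)
    (hL₂ : L₂.card = 4) (hdis : Disjoint L₁ L₂) (hq : q.totalDegree ≤ 4) {T : Finset (ℝ × ℝ)}
    (hT₁ : ∀ P ∈ T, ev q₁ P = 0) (hT₂ : ∀ P ∈ T, ev q₂ P = 0) (hT : ∀ P ∈ T, ev q P = 0)
    (hTc : 14 ≤ T.card) {Q : ℝ × ℝ} (hQ₁ : ev q₁ Q = 0) (hQ₂ : ev q₂ Q = 0) : ev q Q = 0 := by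
  have hcov₁ : ∀ P ∈ T, ∃ s ∈ L₁, P ∈ s := fun P hP => (h₁.ev_eq_zero_iff P).1 (hT₁ P hP)
  have hb : ∀ s ∈ L₁, (pointsOn T s).card ≤ 4 := by
    intro s hs
    have := card_le_of_cover (T := pointsOn T s) (K := L₂) (j := 1)
      (fun P hP => (h₂.ev_eq_zero_iff P).1 (hT₂ P (mem_pointsOn.1 hP).1)) fun t ht => ?_
    · omega
    · refine le_trans (Finset.card_le_card fun P hP => ?_)
        (card_pointsOn_inter_le_one (h₁.isLine s hs)
        (h₂.isLine t ht) (fun h => Finset.disjoint_left.1 hdis hs (h ▸ ht)) T)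
      simp only [mem_pointsOn] at hP ⊢
      exact ⟨hP.1.1, hP.1.2, hP.2⟩
  obtain ⟨s, hs, hc⟩ := exists_lt_card_pointsOn (j := 3) hcov₁ (by omega)
  obtain ⟨R, hRs, hR⟩ :=
    exists_mem_line_ev_ne_zero h₂ (h₁.isLine s hs) (Finset.disjoint_left.1 hdis hs)
  have hRT : R ∉ T := fun h => hR (hT₂ R h)
  let w := q - C (ev q R / ev q₂ R) * q₂
  have hev (P : ℝ × ℝ) : ev w P = ev q P - ev q R / ev q₂ R * ev q₂ P := by
    rw [ev_sub, ev_mul, ev_C]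
  have hw : w.totalDegree ≤ 3 + 1 := by
    refine (totalDegree_sub _ _).trans (max_le hq ((totalDegree_mul _ _).trans ?_))
    rw [totalDegree_C, zero_add]
    exact h₂.totalDegree_le
  have hon : pointsOn (insert R T) s = insert R (pointsOn T s) := by
    simp [pointsOn, Finset.filter_insert, hRs]
  obtain ⟨u, hu, hu0, huL, hwu⟩ := exists_reduced hw h₁.isLine (T := insert R T)
    (by simpa using ⟨⟨s, hs, hRs⟩, by simpa using hcov₁⟩)
    (by
      intro P hP
      rw [hev]
      rcases Finset.mem_insert.1 hP with rfl | hP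
      · rw [div_mul_cancel₀ _ hR, sub_self]
      · rw [hT P hP, hT₂ P hP, mul_zero, sub_zero]) hs
    (by
      rw [hon, Finset.card_insert_of_notMem fun h => hRT (mem_pointsOn.1 h).1]
      omega)
  have hd := card_sdiff_pointsOn (insert R T) s
  rw [hon, Finset.card_insert_of_notMem fun h => hRT (mem_pointsOn.1 h).1,
    Finset.card_insert_of_notMem hRT, ← hon] at hd
  have hsub : insert R T \ pointsOn (insert R T) s ⊆ T := by
    rw [hon]
    intro P
    simp only [Finset.mem_sdiff, Finset.mem_insert]
    tauto
  obtain ⟨t, ht, hQt⟩ := (h₁.ev_eq_zero_iff Q).1 hQ₁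
  have hwQ : ev w Q = 0 := by
    refine hwu Q ?_
    by_cases hts : t = s
    · exact Or.inl (hts ▸ hQt)
    · refine Or.inr (cubic_eq_zero_of_three_lines hu
        (fun s hs => h₁.isLine s (Finset.mem_of_mem_erase hs))
        (by rw [Finset.card_erase_of_mem hs, hL₁]) huL hu0
        (fun s' hs' => (card_pointsOn_mono hsub s').trans (hb s' (Finset.mem_of_mem_erase hs')))
        ?_ (Finset.mem_erase.2 ⟨hts, ht⟩) hQt)
      have := hb s hs
      omega
  rwa [hev, hQ₂, mul_zero, sub_zero] at hwQ

/-- The split quartic `q` is nonzero at the point `A` of `Y` and vanishes at all the others. -/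
structure Separates (Y : Finset (ℝ × ℝ)) (q : MvPolynomial (Fin 2) ℝ) (L : Finset (Set (ℝ × ℝ)))
    (A : ℝ × ℝ) : Prop where
  split : IsSplitQuartic q L
  mem : A ∈ Y
  ev_ne_zero : ev q A ≠ 0
  ev_eq_zero : ∀ P ∈ Y, P ≠ A → ev q P = 0

section Separates

variable {Y : Finset (ℝ × ℝ)} {qA qB qC qD : MvPolynomial (Fin 2) ℝ}
  {LA LB LC LD : Finset (Set (ℝ × ℝ))} {A B C D : ℝ × ℝ}

lemma Separates.exists_mem (hA : Separates Y qA LA A) {P : ℝ × ℝ} (hP : P ∈ Y) (hPA : P ≠ A) :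
    ∃ s ∈ LA, P ∈ s :=
  (hA.split.ev_eq_zero_iff P).1 (hA.ev_eq_zero P hP hPA)

lemma Separates.notMem (hA : Separates Y qA LA A) {s : Set (ℝ × ℝ)} (hs : s ∈ LA) : A ∉ s :=
  fun h => hA.ev_ne_zero ((hA.split.ev_eq_zero_iff A).2 ⟨s, hs, h⟩)

lemma Separates.card_eq_four (hA : Separates Y qA LA A) (hY : 17 ≤ Y.card)
    (h5 : ∀ s, IsLine s → (pointsOn Y s).card ≤ 5) : LA.card = 4 := by
  refine hA.split.card_le.antisymm ?_
  have h := card_le_of_cover (T := Y.erase A) (K := LA) (j := 5)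
    (fun P hP => hA.exists_mem (Finset.mem_of_mem_erase hP) (Finset.ne_of_mem_erase hP))
    fun s hs => (card_pointsOn_mono (Finset.erase_subset _ _) s).trans (h5 s (hA.split.isLine s hs))
  rw [Finset.card_erase_of_mem hA.mem] at h
  omega

lemma Separates.card_inter_eq (hA : Separates Y qA LA A) (hB : Separates Y qB LB B) (hAB : A ≠ B)
    (hY : 17 ≤ Y.card) (h5 : ∀ s, IsLine s → (pointsOn Y s).card ≤ 5) :
    (LA ∩ LB).card = 0 ∨ (LA ∩ LB).card = 3 := by
  have hA4 := hA.card_eq_four hY h5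
  have hB4 := hB.card_eq_four hY h5
  have hT : ((Y.erase A).erase B).card = Y.card - 2 := by
    rw [Finset.card_erase_of_mem (Finset.mem_erase.2 ⟨hAB.symm, hB.mem⟩),
      Finset.card_erase_of_mem hA.mem]
    omega
  let U := {P ∈ (Y.erase A).erase B | ∃ s ∈ LA ∩ LB, P ∈ s}
  let V := {P ∈ (Y.erase A).erase B | ¬ ∃ s ∈ LA ∩ LB, P ∈ s}
  have hUV : U.card + V.card = Y.card - 2 := by
    rw [← hT]
    exact Finset.card_filter_add_card_filter_not _
  have hU : U.card ≤ (LA ∩ LB).card * 5 := by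
    refine card_le_of_cover (fun P hP => (Finset.mem_filter.1 hP).2) fun s hs => ?_
    refine (card_pointsOn_mono ?_ s).trans (h5 s (hA.split.isLine s (Finset.mem_inter.1 hs).1))
    exact (Finset.filter_subset _ _).trans ((Finset.erase_subset _ _).trans
      (Finset.erase_subset _ _))
  have hV : V.card ≤ (LA \ LB).card * (LB \ LA).card := by
    rw [← Finset.card_product, ← mul_one (Finset.card (_ ×ˢ _))]
    refine (card_le_of_cover (K := ((LA \ LB) ×ˢ (LB \ LA)).image fun x => x.1 ∩ x.2) (j := 1)
      ?_ ?_).trans (Nat.mul_le_mul_right _ Finset.card_image_le)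
    · intro P hP
      simp only [V, Finset.mem_filter, Finset.mem_erase, Finset.mem_inter, not_exists] at hP
      obtain ⟨⟨hPB, hPA, hPY⟩, hP⟩ := hP
      obtain ⟨s, hs, hPs⟩ := hA.exists_mem hPY hPA
      obtain ⟨t, ht, hPt⟩ := hB.exists_mem hPY hPB
      refine ⟨s ∩ t, Finset.mem_image.2 ⟨(s, t), ?_, rfl⟩, hPs, hPt⟩
      rw [Finset.mem_product, Finset.mem_sdiff, Finset.mem_sdiff]
      exact ⟨⟨hs, fun h => hP s ⟨⟨hs, h⟩, hPs⟩⟩, ⟨ht, fun h => hP t ⟨⟨h, ht⟩, hPt⟩⟩⟩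
    · intro s hs
      obtain ⟨⟨a, b⟩, hab, rfl⟩ := Finset.mem_image.1 hs
      rw [Finset.mem_product, Finset.mem_sdiff, Finset.mem_sdiff] at hab
      exact card_pointsOn_inter_le_one (hA.split.isLine a hab.1.1) (hB.split.isLine b hab.2.1)
        (fun h => hab.1.2 (h ▸ hab.2.1)) V
  have h₁ := Finset.card_sdiff_add_card_inter LA LB
  have h₂ := Finset.card_sdiff_add_card_inter LB LA
  rw [Finset.inter_comm LB LA] at h₂
  have h₃ : (LA ∩ LB).card ≠ 4 := by
    intro h
    have hBA : LB ⊆ LA := by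
      have : LA ∩ LB = LB := Finset.eq_of_subset_of_card_le Finset.inter_subset_right (by omega)
      exact Finset.inter_eq_right.1 this
    obtain ⟨s, hs, hAs⟩ := hB.exists_mem hA.mem hAB
    exact hA.notMem (hBA hs) hAs
  generalize (LA \ LB).card = a at *
  generalize (LB \ LA).card = b at *
  generalize (LA ∩ LB).card = c at *
  obtain rfl : a = 4 - c := by omega
  obtain rfl : b = 4 - c := by omega
  have : c ≤ 4 := by omega
  interval_cases c <;> omega

lemma Separates.card_inter_eq_three (hA : Separates Y qA LA A) (hB : Separates Y qB LB B)
    (hC : Separates Y qC LC C) (hAB : A ≠ B) (hAC : A ≠ C) (hBC : B ≠ C)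
    (hY : 17 ≤ Y.card) (h5 : ∀ s, IsLine s → (pointsOn Y s).card ≤ 5) : (LA ∩ LB).card = 3 := by
  refine (hA.card_inter_eq hB hAB hY h5).resolve_left fun h => hC.ev_ne_zero ?_
  refine ev_eq_zero_of_disjoint hA.split hB.split (hA.card_eq_four hY h5) (hB.card_eq_four hY h5)
    (Finset.disjoint_iff_inter_eq_empty.2 (Finset.card_eq_zero.1 h)) hC.split.totalDegree_le
    (T := ((Y.erase A).erase B).erase C) ?_ ?_ ?_ ?_
    (hA.ev_eq_zero C hC.mem hAC.symm) (hB.ev_eq_zero C hC.mem hBC.symm)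
  · intro P hP
    simp only [Finset.mem_erase] at hP
    exact hA.ev_eq_zero P hP.2.2.2 hP.2.2.1
  · intro P hP
    simp only [Finset.mem_erase] at hP
    exact hB.ev_eq_zero P hP.2.2.2 hP.2.1
  · intro P hP
    simp only [Finset.mem_erase] at hP
    exact hC.ev_eq_zero P hP.2.2.2 hP.1
  · have h₁ := Finset.pred_card_le_card_erase (s := Y) (a := A)
    have h₂ := Finset.pred_card_le_card_erase (s := Y.erase A) (a := B)
    have h₃ := Finset.pred_card_le_card_erase (s := (Y.erase A).erase B) (a := C)
    omega

lemma Separates.inter_subset (hA : Separates Y qA LA A) (hB : Separates Y qB LB B)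
    (hC : Separates Y qC LC C) (hAB : A ≠ B) (hAC : A ≠ C) (hBC : B ≠ C)
    (hY : 17 ≤ Y.card) (h5 : ∀ s, IsLine s → (pointsOn Y s).card ≤ 5) : LA ∩ LB ⊆ LC := by
  by_contra hsub
  obtain ⟨x, hx, hxC⟩ := Finset.not_subset.1 hsub
  have hxA := (Finset.mem_inter.1 hx).1
  have hxB := (Finset.mem_inter.1 hx).2
  have hABc := hA.card_inter_eq_three hB hC hAB hAC hBC hY h5
  have hACc := hA.card_inter_eq_three hC hB hAC hAB hBC.symm hY h5
  have hBCc := hB.card_inter_eq_three hC hA hBC hAB.symm hAC.symm hY h5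
  have hA4 := hA.card_eq_four hY h5
  have hB4 := hB.card_eq_four hY h5
  have hC4 := hC.card_eq_four hY h5
  have hAC' : LA ∩ LC = LA.erase x := by
    refine Finset.eq_of_subset_of_card_le (fun s hs => ?_) ?_
    · rw [Finset.mem_inter] at hs
      exact Finset.mem_erase.2 ⟨fun h => hxC (h ▸ hs.2), hs.1⟩
    · rw [Finset.card_erase_of_mem hxA]
      omega
  have hBC' : LB ∩ LC = LB.erase x := by
    refine Finset.eq_of_subset_of_card_le (fun s hs => ?_) ?_
    · rw [Finset.mem_inter] at hs
      exact Finset.mem_erase.2 ⟨fun h => hxC (h ▸ hs.2), hs.1⟩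
    · rw [Finset.card_erase_of_mem hxB]
      omega
  have hAsub : LA.erase x ⊆ LC := hAC' ▸ Finset.inter_subset_right
  have hBsub : LB.erase x ⊆ LC := hBC' ▸ Finset.inter_subset_right
  obtain ⟨a, ha⟩ : ∃ a, LA \ LB = {a} := Finset.card_eq_one.1 (by
    have := Finset.card_sdiff_add_card_inter LA LB
    omega)
  obtain ⟨b, hb⟩ : ∃ b, LB \ LA = {b} := Finset.card_eq_one.1 (by
    have := Finset.card_sdiff_add_card_inter LB LA
    rw [Finset.inter_comm] at this
    omega)
  have haA : a ∈ LA ∧ a ∉ LB := Finset.mem_sdiff.1 (ha ▸ Finset.mem_singleton_self a)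
  have hbB : b ∈ LB ∧ b ∉ LA := Finset.mem_sdiff.1 (hb ▸ Finset.mem_singleton_self b)
  have hxa : x ≠ a := fun h => haA.2 (h ▸ hxB)
  have hxb : x ≠ b := fun h => hbB.2 (h ▸ hxA)
  have hab : a ≠ b := fun h => haA.2 (h ▸ hbB.1)
  have hGc : ((LA ∩ LB).erase x).card = 2 := by rw [Finset.card_erase_of_mem hx, hABc]
  have hLC : LC = LA.erase x ∪ LB.erase x := by
    refine (Finset.eq_of_subset_of_card_le (Finset.union_subset hAsub hBsub) ?_).symm
    have := Finset.card_union_add_card_inter (LA.erase x) (LB.erase x)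
    have hinter : LA.erase x ∩ LB.erase x = (LA ∩ LB).erase x := by
      ext s
      simp only [Finset.mem_inter, Finset.mem_erase]
      tauto
    rw [hinter, hGc, Finset.card_erase_of_mem hxA,
      Finset.card_erase_of_mem hxB] at this
    omega
  let T := ((Y.erase A).erase B).erase C
  have hTc : 14 ≤ T.card := by
    change 14 ≤ (((Y.erase A).erase B).erase C).card
    have h₁ := Finset.pred_card_le_card_erase (s := Y) (a := A)
    have h₂ := Finset.pred_card_le_card_erase (s := Y.erase A) (a := B)
    have h₃ := Finset.pred_card_le_card_erase (s := (Y.erase A).erase B) (a := C)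
    omega
  let U := {P ∈ T | ∃ s ∈ (LA ∩ LB).erase x, P ∈ s}
  let V := {P ∈ T | ¬ ∃ s ∈ (LA ∩ LB).erase x, P ∈ s}
  have hUV : U.card + V.card = T.card := Finset.card_filter_add_card_filter_not _
  have hU : U.card ≤ ((LA ∩ LB).erase x).card * 5 := by
    refine card_le_of_cover (fun P hP => (Finset.mem_filter.1 hP).2) fun s hs => ?_
    refine (card_pointsOn_mono ?_ s).trans (h5 s (hA.split.isLine s
      (Finset.mem_inter.1 (Finset.mem_of_mem_erase hs)).1))
    exact (Finset.filter_subset _ _).trans ((Finset.erase_subset _ _).trans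
      ((Finset.erase_subset _ _).trans (Finset.erase_subset _ _)))
  have hV : V.card ≤ ({x ∩ a, x ∩ b, a ∩ b} : Finset (Set (ℝ × ℝ))).card * 1 := by
    refine card_le_of_cover (fun P hP => ?_) ?_
    · simp only [V, T, Finset.mem_filter, Finset.mem_erase, Finset.mem_inter, not_exists,
        not_and] at hP
      obtain ⟨⟨hPC, hPB, hPA, hPY⟩, hP⟩ := hP
      have hPA' : P ∈ x ∨ P ∈ a := by
        obtain ⟨s, hs, hPs⟩ := hA.exists_mem hPY hPA
        by_cases hsx : s = x
        · exact Or.inl (hsx ▸ hPs)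
        · have : s ∈ LA \ LB := Finset.mem_sdiff.2 ⟨hs, fun h => hP s ⟨hsx, hs, h⟩ hPs⟩
          rw [ha, Finset.mem_singleton] at this
          exact Or.inr (this ▸ hPs)
      have hPB' : P ∈ x ∨ P ∈ b := by
        obtain ⟨s, hs, hPs⟩ := hB.exists_mem hPY hPB
        by_cases hsx : s = x
        · exact Or.inl (hsx ▸ hPs)
        · have : s ∈ LB \ LA := Finset.mem_sdiff.2 ⟨hs, fun h => hP s ⟨hsx, h, hs⟩ hPs⟩
          rw [hb, Finset.mem_singleton] at this
          exact Or.inr (this ▸ hPs)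
      have hPC' : P ∈ a ∨ P ∈ b := by
        obtain ⟨s, hs, hPs⟩ := hC.exists_mem hPY hPC
        rw [hLC, Finset.mem_union, Finset.mem_erase, Finset.mem_erase] at hs
        rcases hs with ⟨hsx, hs⟩ | ⟨hsx, hs⟩
        · have : s ∈ LA \ LB := Finset.mem_sdiff.2 ⟨hs, fun h => hP s ⟨hsx, hs, h⟩ hPs⟩
          rw [ha, Finset.mem_singleton] at this
          exact Or.inl (this ▸ hPs)
        · have : s ∈ LB \ LA := Finset.mem_sdiff.2 ⟨hs, fun h => hP s ⟨hsx, h, hs⟩ hPs⟩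
          rw [hb, Finset.mem_singleton] at this
          exact Or.inr (this ▸ hPs)
      simp only [Finset.mem_insert, Finset.mem_singleton, exists_eq_or_imp, exists_eq_left,
        Set.mem_inter_iff]
      tauto
    · have hlx := hA.split.isLine x hxA
      have hla := hA.split.isLine a haA.1
      have hlb := hB.split.isLine b hbB.1
      simp only [Finset.mem_insert, Finset.mem_singleton, forall_eq_or_imp, forall_eq]
      exact ⟨card_pointsOn_inter_le_one hlx hla hxa V, card_pointsOn_inter_le_one hlx hlb hxb V,
        card_pointsOn_inter_le_one hla hlb hab V⟩
  have h3 : ({x ∩ a, x ∩ b, a ∩ b} : Finset (Set (ℝ × ℝ))).card ≤ 3 := Finset.card_le_three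
  omega

/-- If no line contains more than five of at least seventeen points, then at most three of the
points are separated from the others by split quartics. -/
lemma Separates.false_of_four (hA : Separates Y qA LA A) (hB : Separates Y qB LB B)
    (hC : Separates Y qC LC C) (hD : Separates Y qD LD D) (hAB : A ≠ B) (hAC : A ≠ C)
    (hAD : A ≠ D) (hBC : B ≠ C) (hBD : B ≠ D) (hCD : C ≠ D)
    (hY : 17 ≤ Y.card) (h5 : ∀ s, IsLine s → (pointsOn Y s).card ≤ 5) : False := by
  have hABc := hA.card_inter_eq_three hB hC hAB hAC hBC hY h5
  have hsubC := hA.inter_subset hB hC hAB hAC hBC hY h5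
  have hsubD := hA.inter_subset hB hD hAB hAD hBD hY h5
  have hA4 := hA.card_eq_four hY h5
  have hB4 := hB.card_eq_four hY h5
  have hAone : (LA \ (LA ∩ LB)).card ≤ 1 := by
    rw [Finset.card_sdiff_of_subset Finset.inter_subset_left]
    omega
  have hBone : (LB \ (LA ∩ LB)).card ≤ 1 := by
    rw [Finset.card_sdiff_of_subset Finset.inter_subset_right]
    omega
  have keyA {P : ℝ × ℝ} {q L} (hP : Separates Y q L P) (hPA : P ≠ A) (hL : LA ∩ LB ⊆ L) :
      ∃ s ∈ LA \ (LA ∩ LB), P ∈ s := by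
    obtain ⟨s, hs, hPs⟩ := hA.exists_mem hP.mem hPA
    exact ⟨s, Finset.mem_sdiff.2 ⟨hs, fun h => hP.notMem (hL h) hPs⟩, hPs⟩
  have keyB {P : ℝ × ℝ} {q L} (hP : Separates Y q L P) (hPB : P ≠ B) (hL : LA ∩ LB ⊆ L) :
      ∃ s ∈ LB \ (LA ∩ LB), P ∈ s := by
    obtain ⟨s, hs, hPs⟩ := hB.exists_mem hP.mem hPB
    exact ⟨s, Finset.mem_sdiff.2 ⟨hs, fun h => hP.notMem (hL h) hPs⟩, hPs⟩
  obtain ⟨a, ha, hCa⟩ := keyA hC hAC.symm hsubC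
  obtain ⟨a', ha', hDa⟩ := keyA hD hAD.symm hsubD
  obtain ⟨a'', ha'', hBa⟩ := keyA hB hAB.symm Finset.inter_subset_right
  obtain ⟨b, hb, hCb⟩ := keyB hC hBC.symm hsubC
  obtain ⟨b', hb', hDb⟩ := keyB hD hBD.symm hsubD
  obtain rfl := Finset.card_le_one.1 hAone a ha a' ha'
  obtain rfl := Finset.card_le_one.1 hAone a ha a'' ha''
  obtain rfl := Finset.card_le_one.1 hBone b hb b' hb'
  rw [Finset.mem_sdiff] at ha hb
  obtain rfl := (hA.split.isLine a ha.1).eq (hB.split.isLine b hb.1) hCD hCa hDa hCb hDb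
  exact hB.notMem hb.1 hBa

end Separates

end Counting

lemma IsLinePoly.prime {m : MvPolynomial (Fin 2) ℝ} (hm : IsLinePoly m) : Prime m := by
  refine (irreducible_of_totalDegree_eq_one hm fun x hx => ?_).prime
  refine isUnit_iff_ne_zero.2 fun h => hm.ne_zero ?_
  ext d
  simpa [h] using hx d

/-- A line contains at most `n + 1` nodes of an `n`-poised set with fundamental polynomials. -/
lemma GCSet.nodesOn_le {n : ℕ} {X : Set (ℝ × ℝ)} (hX : GCSet n X) {m : MvPolynomial (Fin 2) ℝ}
    (hm : IsLinePoly m) : nodesOn X m ≤ n + 1 := by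
  classical
  have hfin : (X ∩ lineSet m).Finite := hX.1.1.inter_of_left _
  by_contra! h
  rw [nodesOn, Set.ncard_eq_toFinset_card _ hfin] at h
  obtain ⟨P, hP⟩ := Finset.card_pos.1 (lt_of_le_of_lt (Nat.zero_le _) h)
  have hP' : P ∈ X ∩ lineSet m := by simpa using hP
  obtain ⟨p, ⟨hdeg, hone, hzero⟩, -⟩ := hX.2 P hP'.1
  have := ev_eq_zero_of_card_lt hm (p := p) (T := hfin.toFinset.erase P) ?_ ?_ ?_ hP'.2
  · exact one_ne_zero (hone.symm.trans this)
  · intro Q hQ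
    simp only [Finset.mem_erase, Set.Finite.mem_toFinset] at hQ
    exact hQ.2.2
  · rw [Finset.card_erase_of_mem hP]
    omega
  · intro Q hQ
    simp only [Finset.mem_erase, Set.Finite.mem_toFinset] at hQ
    exact hzero Q hQ.2.1 hQ.1

lemma GCSet.separates {X : Set (ℝ × ℝ)} (hX : GCSet 5 X) {l : MvPolynomial (Fin 2) ℝ}
    (hl : IsLinePoly l) {A : ℝ × ℝ} (hA : A ∈ X) (hAu : Uses 5 X A l)
    {Y : Finset (ℝ × ℝ)} (hY : ∀ P, P ∈ Y ↔ P ∈ X ∧ P ∉ lineSet l) :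
    ∃ q L, Separates Y q L A := by
  classical
  obtain ⟨p, ⟨hdeg, hone, hzero⟩, q, rfl⟩ := hAu
  obtain ⟨p', ⟨hdeg', hone', hzero'⟩, f, hf, hp'⟩ := hX.2 A hA
  have heq : l * q = p' := by
    rw [← sub_eq_zero]
    refine hX.1.2.2 _ ((totalDegree_sub _ _).trans (max_le hdeg hdeg')) fun B hB => ?_
    rw [ev_sub]
    by_cases hBA : B = A
    · rw [hBA, hone, hone', sub_self]
    · rw [hzero B hB hBA, hzero' B hB hBA, sub_self]
  rw [hp'] at heq
  obtain ⟨i, -, hi⟩ := (hl.prime.dvd_finsetProd_iff f).1 (Dvd.intro q heq)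
  obtain ⟨c, hc⟩ := hi
  have hc0 : c ≠ 0 := by
    rintro rfl
    exact (hf i).ne_zero (by rw [hc, mul_zero])
  obtain ⟨r, rfl⟩ : ∃ r, c = C r := by
    refine ⟨_, totalDegree_eq_zero_iff_eq_C.1 ?_⟩
    have := hf i
    rw [IsLinePoly, hc, totalDegree_mul_of_isDomain hl.ne_zero hc0, hl] at this
    omega
  have hq : q = C r * ∏ j ∈ Finset.univ.erase i, f j := by
    refine mul_left_cancel₀ hl.ne_zero ?_
    rw [heq, ← Finset.mul_prod_erase _ f (Finset.mem_univ i), hc, mul_assoc]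
  have hr : r ≠ 0 := fun h => hc0 (by rw [h, C_0])
  rw [ev_mul] at hone
  have hlA : ev l A ≠ 0 := left_ne_zero_of_mul_eq_one hone
  have hqA : ev q A ≠ 0 := right_ne_zero_of_mul_eq_one hone
  refine ⟨q, (Finset.univ.erase i).image fun j => lineSet (f j), ⟨?_, ?_, ?_, ?_⟩,
    (hY A).2 ⟨hA, hlA⟩, hqA, fun P hP hPA => ?_⟩
  · refine Finset.card_image_le.trans ?_
    simp
  · have hq0 : q ≠ 0 := by
      rintro rfl
      simp [ev] at hqA
    rw [totalDegree_mul_of_isDomain hl.ne_zero hq0, hl] at hdeg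
    omega
  · intro s hs
    obtain ⟨j, -, rfl⟩ := Finset.mem_image.1 hs
    exact ⟨f j, hf j, rfl⟩
  · intro P
    rw [hq, ev_mul, ev_C, mul_eq_zero, or_iff_right hr, ev, map_prod, Finset.prod_eq_zero_iff]
    simp [lineSet, ev]
  · rw [hY] at hP
    have := hzero P hP.1 hPA
    rw [ev_mul] at this
    exact (mul_eq_zero.1 this).resolve_left hP.2

/-- in a `GC_5` set with no maximal line, a line used by four distinct nodes
is a 5-node line. -/
theorem line_used_four_times (X : Set (ℝ × ℝ)) (hX : GCSet 5 X) (hnm : NoMaximalLine 5 X)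
    (l : MvPolynomial (Fin 2) ℝ) (hl : IsLinePoly l) (A B C D : ℝ × ℝ)
    (hA : A ∈ X) (hB : B ∈ X) (hC : C ∈ X) (hD : D ∈ X)
    (hAB : A ≠ B) (hAC : A ≠ C) (hAD : A ≠ D) (hBC : B ≠ C) (hBD : B ≠ D) (hCD : C ≠ D)
    (hAu : Uses 5 X A l) (hBu : Uses 5 X B l) (hCu : Uses 5 X C l) (hDu : Uses 5 X D l) :
    nodesOn X l = 5 := by
  classical
  have h6 (m : MvPolynomial (Fin 2) ℝ) (hm : IsLinePoly m) : nodesOn X m ≤ 5 := by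
    have h₁ := hX.nodesOn_le hm
    have h₂ := hnm m hm
    omega
  refine (h6 l hl).antisymm ?_
  by_contra! hlt
  have hfin := hX.1.1
  let Y := hfin.toFinset.filter (· ∉ lineSet l)
  have hY (P : ℝ × ℝ) : P ∈ Y ↔ P ∈ X ∧ P ∉ lineSet l := by simp [Y]
  obtain ⟨qA, LA, hsA⟩ := hX.separates hl hA hAu hY
  obtain ⟨qB, LB, hsB⟩ := hX.separates hl hB hBu hY
  obtain ⟨qC, LC, hsC⟩ := hX.separates hl hC hCu hY
  obtain ⟨qD, LD, hsD⟩ := hX.separates hl hD hDu hY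
  refine hsA.false_of_four hsB hsC hsD hAB hAC hAD hBC hBD hCD ?_ ?_
  · have h := Set.ncard_inter_add_ncard_sdiff_eq_ncard X (lineSet l) hfin
    have hYc : (X \ lineSet l).ncard = Y.card := by
      rw [← Set.ncard_coe_finset]
      congr 1
      ext P
      simp [hY]
    rw [hX.1.2.1, hYc] at h
    rw [nodesOn] at hlt
    omega
  · rintro s ⟨m, hm, rfl⟩
    refine le_trans ?_ (h6 m hm)
    rw [nodesOn, ← Set.ncard_coe_finset]
    refine Set.ncard_le_ncard (fun P hP => ?_) (hfin.inter_of_left _)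
    rw [Finset.mem_coe, mem_pointsOn, hY] at hP
    exact ⟨hP.1.1, hP.2⟩
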